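/- There is no skew-symmetric amorphous association scheme with 4 classes: for every n ≥ 1 and every family A_0, A_1, A_2, A_3, A_4 of n×n real matrices forming an association scheme with 4 classes, if the scheme is skew-symmetric then it is not amorphous. -/

import Mathlib

open Matrix BigOperators

/-- An association scheme on `n` vertices, encoded as a family of `n × n`
real `0/1`-matrices indexed by `ι`: `e` is the index of the diagonal (identity)
relation and `σ` is the pairing sending each relation to its transpose.
All relations are nonempty, the identity relation is the identity matrix,
the relations partition `X × X` (the matrices sum to the all-ones matrix `J`),
the family is closed under transposition, and products of the matrices are
nonnegative-integer linear combinations of the matrices. -/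
def IsAssocScheme {ι : Type} [Fintype ι] (n : ℕ)
    (A : ι → Matrix (Fin n) (Fin n) ℝ) (e : ι) (σ : ι → ι) : Prop :=
  (∀ i, A i ≠ 0) ∧
  (∀ i x y, A i x y = 0 ∨ A i x y = 1) ∧
  A e = 1 ∧
  (∑ i, A i) = Matrix.of (fun _ _ => (1 : ℝ)) ∧
  (∀ i, (A i)ᵀ = A (σ i)) ∧
  (∀ i j, ∃ p : ι → ℕ, A i * A j = ∑ k, (p k : ℝ) • A k)

/-- `Λ` is a partition of the index set `ι`: its blocks are nonempty and every
index lies in exactly one block. -/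
def IsPartition {ι : Type} [Fintype ι] [DecidableEq ι]
    (Λ : Finset (Finset ι)) : Prop :=
  (∀ C ∈ Λ, C.Nonempty) ∧ ∀ i : ι, ∃! C, C ∈ Λ ∧ i ∈ C

/-- A partition `Λ` of the index set is admissible (for a scheme with diagonal
index `e` and transpose pairing `σ`) if `{e}` is a block of `Λ` and the image
of every block under the pairing `σ` is again a block. -/
def Admissible {ι : Type} [Fintype ι] [DecidableEq ι]
    (e : ι) (σ : ι → ι) (Λ : Finset (Finset ι)) : Prop :=
  ({e} : Finset ι) ∈ Λ ∧ ∀ C ∈ Λ, C.image σ ∈ Λ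

/-- The partition `Λ` gives rise to a fusion scheme: the block sums
`B_C = ∑_{i ∈ C} A_i`, indexed by the blocks of `Λ`, again form an
association scheme, with diagonal block `{e}`. -/
def GivesFusion {ι : Type} [Fintype ι] [DecidableEq ι] (n : ℕ)
    (A : ι → Matrix (Fin n) (Fin n) ℝ) (e : ι) (Λ : Finset (Finset ι)) : Prop :=
  ∃ (E : {C // C ∈ Λ}) (σ' : {C // C ∈ Λ} → {C // C ∈ Λ}),
    (E : Finset ι) = {e} ∧
    IsAssocScheme n (fun C : {C // C ∈ Λ} => ∑ i ∈ (C : Finset ι), A i) E σ'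

/-- The scheme is amorphous: every admissible partition of the index set gives
rise to a fusion scheme. -/
def Amorphous {ι : Type} [Fintype ι] [DecidableEq ι] (n : ℕ)
    (A : ι → Matrix (Fin n) (Fin n) ℝ) (e : ι) (σ : ι → ι) : Prop :=
  ∀ Λ : Finset (Finset ι), IsPartition Λ → Admissible e σ Λ → GivesFusion n A e Λ

/-- the all-ones matrix -/
def Jm (n : ℕ) : Matrix (Fin n) (Fin n) ℝ := Matrix.of (fun _ _ => (1 : ℝ))

lemma Jm_mul_Jm (n : ℕ) : Jm n * Jm n = (n : ℝ) • Jm n := by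
  ext x y; simp [Jm, Matrix.mul_apply]

lemma Jm_transpose (n : ℕ) : (Jm n)ᵀ = Jm n := by
  ext x y; simp [Jm]

lemma mul_Jm_apply {n : ℕ} (M : Matrix (Fin n) (Fin n) ℝ) (x y : Fin n) :
    (M * Jm n) x y = ∑ z, M x z := by
  simp [Jm, Matrix.mul_apply]

lemma Jm_smul_inj {n : ℕ} (hn : 1 ≤ n) {a b : ℝ} (h : a • Jm n = b • Jm n) : a = b := by
  have := congrFun (congrFun h ⟨0, hn⟩) ⟨0, hn⟩
  simpa [Jm] using this

lemma exists_one {n : ℕ} {M : Matrix (Fin n) (Fin n) ℝ} (h : M ≠ 0)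
    (h01 : ∀ x y, M x y = 0 ∨ M x y = 1) : ∃ x y, M x y = 1 := by
  by_contra hc
  push Not at hc
  apply h
  ext x y
  rcases h01 x y with h | h
  · simpa using h
  · exact absurd h (hc x y)

/-- row sums from the diagonal of `M Mᵀ` -/
lemma mul_Jm_of_diag {n : ℕ} {M : Matrix (Fin n) (Fin n) ℝ} {t : ℝ}
    (h01 : ∀ x y, M x y = 0 ∨ M x y = 1)
    (hd : ∀ x, (M * Mᵀ) x x = t) : M * Jm n = t • Jm n := by
  ext x y
  rw [mul_Jm_apply, ← hd x]
  simp only [Jm, Matrix.smul_apply, Matrix.of_apply, smul_eq_mul, mul_one, Matrix.mul_apply,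
    Matrix.transpose_apply]
  refine Finset.sum_congr rfl fun z _ => ?_
  rcases h01 x z with h | h <;> simp [h]

/-- row and column sums coincide when both are constant. -/
lemma const_row_col {n : ℕ} (hn : 1 ≤ n) {M : Matrix (Fin n) (Fin n) ℝ} {s t : ℝ}
    (h1 : M * Jm n = s • Jm n) (h2 : Mᵀ * Jm n = t • Jm n) : s = t := by
  have h3 : Jm n * M = t • Jm n := by
    have := congrArg Matrix.transpose h2
    simpa [Matrix.transpose_mul, Jm_transpose] using this
  have h4 : Jm n * M * Jm n = (t * n) • Jm n := by
    rw [h3, Matrix.smul_mul, Jm_mul_Jm, smul_smul]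
  have h5 : Jm n * M * Jm n = (s * n) • Jm n := by
    rw [Matrix.mul_assoc, h1, Matrix.mul_smul, Jm_mul_Jm, smul_smul]
  have h6 := Jm_smul_inj hn (h5.symm.trans h4)
  have : (n : ℝ) ≠ 0 := by positivity
  exact mul_right_cancel₀ this h6

/-- doubly regular tournaments -/
lemma drt {n : ℕ} (hn : 1 ≤ n) {T : Matrix (Fin n) (Fin n) ℝ} (hT : T ≠ 0)
    (h01 : ∀ x y, T x y = 0 ∨ T x y = 1) (hJ : 1 + T + Tᵀ = Jm n)
    (hp : ∃ a b c : ℕ, T * Tᵀ = (a : ℝ) • (1 : Matrix (Fin n) (Fin n) ℝ) + (b : ℝ) • T + (c : ℝ) • Tᵀ) :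
    ∃ m : ℕ, n = 4 * m + 3 ∧ (T - Tᵀ) * (T - Tᵀ) = Jm n - (n : ℝ) • 1 := by
  obtain ⟨t, lam, mu, hp⟩ := hp
  have hpt : ∀ x y, (1 : Matrix (Fin n) (Fin n) ℝ) x y + T x y + T y x = 1 := fun x y => by
    have := congrFun (congrFun hJ x) y
    simpa [Jm] using this
  have hdiag : ∀ x, T x x = 0 := fun x => by
    have := hpt x x
    simp only [Matrix.one_apply_eq] at this
    linarith
  obtain ⟨x, y, hxy⟩ := exists_one hT h01
  have hne : x ≠ y := by
    rintro rfl
    rw [hdiag] at hxy; norm_num at hxy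
  have hyx : T y x = 0 := by
    have := hpt x y
    rw [Matrix.one_apply_ne hne] at this
    linarith
  have hlm : (lam : ℝ) = mu := by
    have e1 := congrFun (congrFun hp x) y
    have e2 := congrFun (congrFun hp y) x
    have e3 : (T * Tᵀ) x y = (T * Tᵀ) y x := by
      simp [Matrix.mul_apply, mul_comm]
    simp [hne, hne.symm, hxy, hyx] at e1 e2
    simp only [Matrix.mul_apply, Matrix.transpose_apply] at e3
    simp only [Matrix.mul_apply, Matrix.transpose_apply] at e1 e2
    linarith
  rw [← hlm] at hp
  have r1 : T * Jm n = (t : ℝ) • Jm n := mul_Jm_of_diag h01 fun x => by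
    rw [hp]; simp [hdiag]
  have r2 : Tᵀ * Jm n = ((n : ℝ) - 1 - t) • Jm n := by
    have : Tᵀ = Jm n - 1 - T := by rw [← hJ]; abel
    rw [this, Matrix.sub_mul, Matrix.sub_mul, r1, Jm_mul_Jm, Matrix.one_mul]
    module
  have e1 := const_row_col hn r1 r2
  have r2' : Tᵀ * Jm n = (t : ℝ) • Jm n := by rw [r2, ← e1]
  have r3 : Jm n * Tᵀ = (t : ℝ) • Jm n := by
    have := congrArg Matrix.transpose r1
    simpa [Matrix.transpose_mul, Jm_transpose] using this
  have ht : (t : ℝ) ≠ 0 := by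
    intro h0
    have := congrFun (congrFun r1 x) y
    rw [mul_Jm_apply, h0] at this
    simp only [zero_smul, Matrix.zero_apply] at this
    have h2 := (Finset.sum_eq_zero_iff_of_nonneg (fun z _ => by
      rcases h01 x z with h | h <;> simp [h])).1 this y (Finset.mem_univ _)
    rw [hxy] at h2; norm_num at h2
  have e2 : (t : ℝ) * t = t + 2 * lam * t := by
    apply Jm_smul_inj hn
    have h := congrArg (· * Jm n) hp
    simp only [Matrix.add_mul, Matrix.smul_mul, Matrix.mul_assoc, r1, r2', Matrix.mul_smul,
      smul_smul, Matrix.one_mul] at h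
    rw [h]; module
  have e3 : (t : ℝ) = 1 + 2 * lam := by
    apply mul_right_cancel₀ ht
    linarith
  refine ⟨lam, ?_, ?_⟩
  · have : (n : ℝ) = 4 * lam + 3 := by linarith
    exact_mod_cast this
  · have hTt : Tᵀ = Jm n - 1 - T := by rw [← hJ]; abel
    have hs1 : T - Tᵀ = (2 : ℝ) • T - Jm n + 1 := by
      rw [← hJ]; module
    have hs2 : T - Tᵀ = -((2 : ℝ) • Tᵀ - Jm n + 1) := by
      rw [← hJ]; module
    have : (T - Tᵀ) * (T - Tᵀ) = ((2 : ℝ) • T - Jm n + 1) * -((2 : ℝ) • Tᵀ - Jm n + 1) := by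
      rw [← hs1, ← hs2]
    rw [this]
    simp only [Matrix.mul_neg, Matrix.add_mul, Matrix.sub_mul, Matrix.mul_add, Matrix.mul_sub,
      Matrix.smul_mul, Matrix.mul_smul, hp, r1, r3, Jm_mul_Jm, Matrix.one_mul, Matrix.mul_one]
    have hn' : (n : ℝ) = 4 * lam + 3 := by linarith
    rw [hn', e3]
    rw [hTt]
    module

lemma arith {n m k l : ℕ} {c : ℤ} (hn : n = 4 * m + 3) (hl : 0 < l)
    (h : (((n : ℤ) - 1) * c + k) ^ 2 = (l : ℤ) ^ 2 * n) : False := by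
  have hd : (l : ℤ) ^ 2 ∣ (((n : ℤ) - 1) * c + k) ^ 2 := ⟨n, h⟩
  rw [Int.pow_dvd_pow_iff two_ne_zero] at hd
  obtain ⟨q, hq⟩ := hd
  rw [hq, mul_pow] at h
  have hl' : (l : ℤ) ^ 2 ≠ 0 := by positivity
  have h2 := mul_left_cancel₀ hl' h
  rw [hn] at h2
  push_cast at h2
  have : q ^ 2 % 4 = 3 := by omega
  rcases Int.even_or_odd' q with ⟨r, rfl | rfl⟩ <;> ring_nf at this <;> omega

lemma core {n : ℕ} (hn : 1 ≤ n) {P Q : Matrix (Fin n) (Fin n) ℝ} (hP : P ≠ 0) (hQ : Q ≠ 0)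
    (P01 : ∀ x y, P x y = 0 ∨ P x y = 1) (Q01 : ∀ x y, Q x y = 0 ∨ Q x y = 1)
    (hJ : 1 + P + Pᵀ + Q + Qᵀ = Jm n)
    (hT1 : ∃ a b c : ℕ, (P + Q) * (P + Q)ᵀ = (a : ℝ) • (1 : Matrix (Fin n) (Fin n) ℝ)
      + (b : ℝ) • (P + Q) + (c : ℝ) • (P + Q)ᵀ)
    (hT2 : ∃ a b c : ℕ, (P + Qᵀ) * (P + Qᵀ)ᵀ = (a : ℝ) • (1 : Matrix (Fin n) (Fin n) ℝ)
      + (b : ℝ) • (P + Qᵀ) + (c : ℝ) • (P + Qᵀ)ᵀ)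
    (h1 : ∃ a b c d : ℕ, P * Pᵀ = (a : ℝ) • (1 : Matrix (Fin n) (Fin n) ℝ)
      + (b : ℝ) • P + (c : ℝ) • Pᵀ + (d : ℝ) • (Q + Qᵀ))
    (h2 : ∃ a b c d : ℕ, Pᵀ * P = (a : ℝ) • (1 : Matrix (Fin n) (Fin n) ℝ)
      + (b : ℝ) • P + (c : ℝ) • Pᵀ + (d : ℝ) • (Q + Qᵀ))
    (h3 : ∃ a b c d : ℕ, P * P = (a : ℝ) • (1 : Matrix (Fin n) (Fin n) ℝ)
      + (b : ℝ) • P + (c : ℝ) • Pᵀ + (d : ℝ) • (Q + Qᵀ))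
    (h4 : ∃ a b c d e : ℝ, (P - Pᵀ) * (Q - Qᵀ) = a • (1 : Matrix (Fin n) (Fin n) ℝ)
      + b • P + c • Pᵀ + d • Q + e • Qᵀ) : False := by
  have hn0 : (n : ℝ) ≠ 0 := by positivity
  have P0 : ∀ x y, 0 ≤ P x y := fun x y => by rcases P01 x y with h | h <;> simp [h]
  have Q0 : ∀ x y, 0 ≤ Q x y := fun x y => by rcases Q01 x y with h | h <;> simp [h]
  have I0 : ∀ x y, 0 ≤ (1 : Matrix (Fin n) (Fin n) ℝ) x y := fun x y => by
    by_cases h : x = y <;> simp [h, Matrix.one_apply]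
  have hpt : ∀ x y, (1 : Matrix (Fin n) (Fin n) ℝ) x y + P x y + P y x + Q x y + Q y x = 1 :=
    fun x y => by
      have := congrFun (congrFun hJ x) y
      simpa [Jm] using this
  have Pd : ∀ x, P x x = 0 := fun x => by
    have := hpt x x
    rw [Matrix.one_apply_eq] at this
    linarith [P0 x x, Q0 x x]
  have Qd : ∀ x, Q x x = 0 := fun x => by
    have := hpt x x
    rw [Matrix.one_apply_eq] at this
    linarith [P0 x x, Q0 x x]
  have PP : ∀ x y, P x y * P y x = 0 := fun x y => by
    rcases P01 x y with h | h
    · simp [h]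
    · have : P y x = 0 := by linarith [hpt x y, P0 y x, Q0 x y, Q0 y x, I0 x y]
      simp [this]
  have QQ : ∀ x y, Q x y * Q y x = 0 := fun x y => by
    rcases Q01 x y with h | h
    · simp [h]
    · have : Q y x = 0 := by linarith [hpt x y, P0 y x, P0 x y, Q0 y x, I0 x y]
      simp [this]
  have PQ : ∀ x y, P x y * Q x y = 0 := fun x y => by
    rcases P01 x y with h | h
    · simp [h]
    · have : Q x y = 0 := by linarith [hpt x y, P0 y x, Q0 x y, Q0 y x, I0 x y]
      simp [this]
  have PQ' : ∀ x y, P x y * Q y x = 0 := fun x y => by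
    rcases P01 x y with h | h
    · simp [h]
    · have : Q y x = 0 := by linarith [hpt x y, P0 y x, Q0 x y, Q0 y x, I0 x y]
      simp [this]
  obtain ⟨x₀, y₀, hP1⟩ := exists_one hP P01
  obtain ⟨x₁, y₁, hQ1⟩ := exists_one hQ Q01
  have hne0 : x₀ ≠ y₀ := by
    rintro rfl
    rw [Pd] at hP1; norm_num at hP1
  have hne1 : x₁ ≠ y₁ := by
    rintro rfl
    rw [Qd] at hQ1; norm_num at hQ1
  have hP2 : P y₀ x₀ = 0 := by simpa [hP1] using PP x₀ y₀
  have hP3 : Q x₀ y₀ = 0 := by simpa [hP1] using PQ x₀ y₀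
  have hP4 : Q y₀ x₀ = 0 := by simpa [hP1] using PQ' x₀ y₀
  have hQ2 : Q y₁ x₁ = 0 := by simpa [hQ1] using QQ x₁ y₁
  have hQ3 : P x₁ y₁ = 0 := by simpa [hQ1] using PQ x₁ y₁
  have hQ4 : P y₁ x₁ = 0 := by simpa [hQ1] using PQ' y₁ x₁
  -- traces
  have trP : P.trace = 0 := by simp [Matrix.trace, Pd]
  have trQ : Q.trace = 0 := by simp [Matrix.trace, Qd]
  have trPP : (P * P).trace = 0 := by simp [Matrix.trace, Matrix.mul_apply, PP]
  have trQQ : (Q * Q).trace = 0 := by simp [Matrix.trace, Matrix.mul_apply, QQ]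
  have trPQ : (P * Q).trace = 0 := by simp [Matrix.trace, Matrix.mul_apply, PQ']
  have trPQt : (P * Qᵀ).trace = 0 := by simp [Matrix.trace, Matrix.mul_apply, PQ]
  have trPtQ : (Pᵀ * Q).trace = 0 := by
    rw [← Matrix.trace_transpose, Matrix.transpose_mul, Matrix.transpose_transpose,
      Matrix.trace_mul_comm, trPQt]
  have trQP : (Q * P).trace = 0 := by rw [Matrix.trace_mul_comm, trPQ]
  have trQtP : (Qᵀ * P).trace = 0 := by rw [Matrix.trace_mul_comm, trPQt]
  have trQPt : (Q * Pᵀ).trace = 0 := by rw [Matrix.trace_mul_comm, trPtQ]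
  have trPtPt : (Pᵀ * Pᵀ).trace = 0 := by
    rw [← Matrix.transpose_mul, Matrix.trace_transpose, trPP]
  have trQtQt : (Qᵀ * Qᵀ).trace = 0 := by
    rw [← Matrix.transpose_mul, Matrix.trace_transpose, trQQ]
  have trPtQt : (Pᵀ * Qᵀ).trace = 0 := by
    rw [← Matrix.transpose_mul, Matrix.trace_transpose, trQP]
  have trQtPt : (Qᵀ * Pᵀ).trace = 0 := by
    rw [← Matrix.transpose_mul, Matrix.trace_transpose, trPQ]
  have trPPt : 0 < (P * Pᵀ).trace := by
    simp only [Matrix.trace, Matrix.diag, Matrix.mul_apply, Matrix.transpose_apply]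
    refine Finset.sum_pos' (fun x _ => Finset.sum_nonneg fun y _ => mul_self_nonneg _)
      ⟨x₀, Finset.mem_univ _, Finset.sum_pos' (fun y _ => mul_self_nonneg _)
        ⟨y₀, Finset.mem_univ _, by rw [hP1]; norm_num⟩⟩
  have trQQt : 0 < (Q * Qᵀ).trace := by
    simp only [Matrix.trace, Matrix.diag, Matrix.mul_apply, Matrix.transpose_apply]
    refine Finset.sum_pos' (fun x _ => Finset.sum_nonneg fun y _ => mul_self_nonneg _)
      ⟨x₁, Finset.mem_univ _, Finset.sum_pos' (fun y _ => mul_self_nonneg _)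
        ⟨y₁, Finset.mem_univ _, by rw [hQ1]; norm_num⟩⟩
  have trPtP : (Pᵀ * P).trace = (P * Pᵀ).trace := Matrix.trace_mul_comm _ _
  have trQtQ : (Qᵀ * Q).trace = (Q * Qᵀ).trace := Matrix.trace_mul_comm _ _
  -- tournaments
  obtain ⟨m, hm, hS1⟩ := drt hn (T := P + Q) (by
      intro h
      have := congrFun (congrFun h x₀) y₀
      simp [hP1, hP3] at this)
    (fun x y => by
      have := PQ x y
      rcases P01 x y with h | h <;> rcases Q01 x y with h' | h' <;> simp [h, h'] at this ⊢)
    (by rw [← hJ, Matrix.transpose_add]; abel) hT1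
  obtain ⟨-, -, hS2⟩ := drt hn (T := P + Qᵀ) (by
      intro h
      have := congrFun (congrFun h x₀) y₀
      simp [hP1, hP4] at this)
    (fun x y => by
      have := PQ' x y
      rcases P01 x y with h | h <;> rcases Q01 y x with h' | h' <;> simp [h, h'] at this ⊢)
    (by rw [← hJ, Matrix.transpose_add, Matrix.transpose_transpose]; abel) hT2
  -- the skew matrices
  obtain ⟨D, hD⟩ : ∃ D, D = P - Pᵀ := ⟨_, rfl⟩
  obtain ⟨E, hE⟩ : ∃ E, E = Q - Qᵀ := ⟨_, rfl⟩
  have hS1' : D * D + D * E + (E * D + E * E) = Jm n - (n : ℝ) • 1 := by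
    rw [← hS1, hD, hE, Matrix.transpose_add]; noncomm_ring
  have hS2' : D * D - D * E - (E * D - E * E) = Jm n - (n : ℝ) • 1 := by
    rw [← hS2, hD, hE, Matrix.transpose_add, Matrix.transpose_transpose]; noncomm_ring
  have hanti : E * D = - (D * E) := by
    have : (2 : ℝ) • (E * D) = (2 : ℝ) • (- (D * E)) := by
      have := hS1'.trans hS2'.symm
      have e := sub_eq_zero.2 this
      rw [← sub_eq_zero, ← e]
      module
    exact smul_right_injective _ (two_ne_zero) this
  have Dt : Dᵀ = -D := by rw [hD]; simp
  have Et : Eᵀ = -E := by rw [hE]; simp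
  have trDD : (D * D).trace = - 2 * (P * Pᵀ).trace := by
    rw [hD]
    simp only [Matrix.sub_mul, Matrix.mul_sub, Matrix.trace_sub, trPP, trPtPt, trPtP]; ring
  have trEE : (E * E).trace = - 2 * (Q * Qᵀ).trace := by
    rw [hE]
    simp only [Matrix.sub_mul, Matrix.mul_sub, Matrix.trace_sub, trQQ, trQtQt, trQtQ]; ring
  have trDE : (D * E).trace = 0 := by
    rw [hD, hE]
    simp only [Matrix.sub_mul, Matrix.mul_sub, Matrix.trace_sub, trPQ, trPtQt, trPtQ, trPQt]; ring
  have trED : (E * D).trace = 0 := by rw [Matrix.trace_mul_comm, trDE]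
  have hDE0 : D * E = 0 := by
    obtain ⟨a, b, c, d, e, h4⟩ := h4
    rw [← hD, ← hE] at h4
    have hsk : (D * E)ᵀ = -(D * E) := by
      rw [Matrix.transpose_mul, Dt, Et, neg_mul_neg, hanti]
    have hF : ∀ x y, (D * E) y x = - (D * E) x y := fun x y => by
      have := congrFun (congrFun hsk x) y
      simpa only [Matrix.transpose_apply, Matrix.neg_apply] using this
    rw [h4] at hF
    have f1 := hF x₀ x₀
    have f2 := hF x₀ y₀
    have f3 := hF x₁ y₁
    simp [Pd, Qd, hne0, hne0.symm, hP1, hP2, hP3, hP4] at f1 f2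
    simp [hne1, hne1.symm, hQ1, hQ2, hQ3, hQ4] at f3
    have ha : a = 0 := by linarith
    have h5 : D * E = b • D + d • E := by
      rw [h4, ha, hD, hE, f2, f3]; module
    have t1 : (D * E * D).trace = 0 := by
      have s1 : (D * E * D).trace = (D * (D * E)).trace := Matrix.trace_mul_comm _ _
      have s2 : (D * E * D).trace = - (D * (D * E)).trace := by
        rw [Matrix.mul_assoc, hanti, Matrix.mul_neg, Matrix.trace_neg]
      linarith
    have t2 : (D * E * E).trace = 0 := by
      have s1 : (D * E * E).trace = (E * D * E).trace := by
        rw [Matrix.trace_mul_comm, Matrix.mul_assoc]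
      have s2 : (E * D * E).trace = - (D * E * E).trace := by
        rw [hanti, Matrix.neg_mul, Matrix.trace_neg]
      linarith
    rw [h5] at t1 t2
    simp only [Matrix.add_mul, Matrix.smul_mul, Matrix.trace_add, Matrix.trace_smul, trED, trDE,
      trDD, trEE, smul_eq_mul, mul_zero, add_zero, zero_add] at t1 t2
    have hb : b = 0 := by
      rcases mul_eq_zero.1 t1 with h | h
      · exact h
      · linarith
    have hd : d = 0 := by
      rcases mul_eq_zero.1 t2 with h | h
      · exact h
      · linarith
    rw [h5, hb, hd]; simp
  have hDne : ∀ a b : ℝ, a • D = b • D → a = b := fun a b h => by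
    have := congrFun (congrFun h x₀) y₀
    simpa [hD, hP1, hP2] using this
  -- the fusion with classes P, Pᵀ, C
  obtain ⟨B, hB⟩ : ∃ B, B = P + Pᵀ := ⟨_, rfl⟩
  obtain ⟨C, hC⟩ : ∃ C, C = Q + Qᵀ := ⟨_, rfl⟩
  rw [← hC] at h1 h2 h3
  have hJ' : 1 + B + C = Jm n := by rw [← hJ, hB, hC]; abel
  obtain ⟨p, x, x2, y, h1⟩ := h1
  obtain ⟨p', x', x2', y', h2⟩ := h2
  obtain ⟨u, v, w, z, h3⟩ := h3
  have Cs : Cᵀ = C := by rw [hC, Matrix.transpose_add, Matrix.transpose_transpose, add_comm]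
  have Cd : ∀ x, C x x = 0 := fun x => by simp [hC, Qd]
  have hC1 : C x₀ y₀ = 0 := by simp [hC, hP3, hP4]
  have hC2 : C y₀ x₀ = 0 := by simp [hC, hP3, hP4]
  have hx : (x : ℝ) = x2 := by
    have e : (P * Pᵀ) x₀ y₀ = (P * Pᵀ) y₀ x₀ := by simp [Matrix.mul_apply, mul_comm]
    rw [h1] at e
    simpa [hne0, hne0.symm, hP1, hP2, hC1, hC2] using e
  have hx' : (x' : ℝ) = x2' := by
    have e : (Pᵀ * P) x₀ y₀ = (Pᵀ * P) y₀ x₀ := by simp [Matrix.mul_apply, mul_comm]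
    rw [h2] at e
    simpa [hne0, hne0.symm, hP1, hP2, hC1, hC2] using e
  have r1 : P * Jm n = (p : ℝ) • Jm n := mul_Jm_of_diag P01 fun x => by
    rw [h1]; simp [Pd, Cd]
  have r2 : Pᵀ * Jm n = (p' : ℝ) • Jm n := mul_Jm_of_diag (fun x y => P01 y x) fun x => by
    rw [Matrix.transpose_transpose, h2]; simp [Pd, Cd]
  have hpp : (p : ℝ) = p' := const_row_col hn r1 r2
  rw [← hpp] at r2 h2
  rw [← hx] at h1
  rw [← hx'] at h2
  obtain ⟨l, hl⟩ : ∃ l : ℝ, l = n - 1 - 2 * p := ⟨_, rfl⟩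
  have r3 : C * Jm n = l • Jm n := by
    have : C = Jm n - 1 - B := by rw [← hJ']; abel
    rw [this, hB, Matrix.sub_mul, Matrix.sub_mul, Matrix.add_mul, r1, r2, Jm_mul_Jm,
      Matrix.one_mul, hl]
    module
  have hlpos : 0 < l := by
    have := congrFun (congrFun r3 x₁) y₁
    rw [mul_Jm_apply] at this
    simp only [Jm, Matrix.smul_apply, Matrix.of_apply, smul_eq_mul, mul_one] at this
    rw [← this]
    refine Finset.sum_pos' (fun z _ => ?_) ⟨y₁, Finset.mem_univ _, ?_⟩
    · simp only [hC, Matrix.add_apply, Matrix.transpose_apply]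
      linarith [Q0 x₁ z, Q0 z x₁]
    · simp [hC, hQ1, hQ2]
  have tP : (P * Pᵀ).trace = n * p := by
    rw [h1]
    simp [trP, trQ, hC, mul_comm]
  have hpne : (n : ℝ) * p ≠ 0 := by rw [← tP]; exact trPPt.ne'
  have trCP : (C * P).trace = 0 := by rw [hC, Matrix.add_mul, Matrix.trace_add, trQP, trQtP, add_zero]
  have trCPt : (C * Pᵀ).trace = 0 := by
    rw [hC, Matrix.add_mul, Matrix.trace_add, trQPt, trQtPt, add_zero]
  have hxx : (x : ℝ) = x' := by
    have e : (P * Pᵀ * P).trace = (Pᵀ * P * P).trace := by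
      rw [Matrix.mul_assoc, Matrix.trace_mul_comm]
    rw [h1, h2] at e
    simp only [Matrix.add_mul, Matrix.smul_mul, Matrix.trace_add, Matrix.trace_smul, trCP, trPP,
      trPtP, tP, Matrix.one_mul, trP, smul_eq_mul, mul_zero, add_zero, zero_add] at e
    exact mul_right_cancel₀ hpne e
  have hyy : (y : ℝ) = y' := by
    have e1 : (p : ℝ) * p = p + x * p + x * p + y * l := by
      apply Jm_smul_inj hn
      have h := congrArg (· * Jm n) h1
      simp only [Matrix.add_mul, Matrix.smul_mul, Matrix.mul_assoc, r1, r2, r3, Matrix.mul_smul,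
        smul_smul, Matrix.one_mul] at h
      rw [h]; module
    have e2 : (p : ℝ) * p = p + x' * p + x' * p + y' * l := by
      apply Jm_smul_inj hn
      have h := congrArg (· * Jm n) h2
      simp only [Matrix.add_mul, Matrix.smul_mul, Matrix.mul_assoc, r1, r2, r3, Matrix.mul_smul,
        smul_smul, Matrix.one_mul] at h
      rw [h]; module
    rw [← hxx] at e2
    have : (y : ℝ) * l = y' * l := by linarith
    exact mul_right_cancel₀ hlpos.ne' this
  rw [← hxx, ← hyy] at h2
  have hcomm : Pᵀ * P = P * Pᵀ := by rw [h1, h2]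
  have hu : (u : ℝ) = 0 := by
    have e := congrArg Matrix.trace h3
    simp [trPP, trP, trQ, hC] at e
    rcases e with e | e
    · exact_mod_cast e
    · exact absurd (by exact_mod_cast e) hn0
  have h3t : Pᵀ * Pᵀ = (u : ℝ) • (1 : Matrix (Fin n) (Fin n) ℝ)
      + (v : ℝ) • Pᵀ + (w : ℝ) • P + (z : ℝ) • C := by
    rw [← Matrix.transpose_mul, h3]
    simp [Cs]
  obtain ⟨c, hc⟩ : ∃ c : ℝ, c = v - w := ⟨_, rfl⟩
  have hDB : D * B = c • D := by
    rw [hD, hB, Matrix.sub_mul, Matrix.mul_add, Matrix.mul_add, hcomm, h3, h3t, hc]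
    module
  obtain ⟨a, ha⟩ : ∃ a : ℝ, a = v + w - 2 * x := ⟨_, rfl⟩
  obtain ⟨b, hb⟩ : ∃ b : ℝ, b = 2 * z - 2 * y := ⟨_, rfl⟩
  have hDD : D * D = (-(2 * p) : ℝ) • 1 + a • B + b • C := by
    rw [hD, Matrix.sub_mul, Matrix.mul_sub, Matrix.mul_sub, hcomm, h3, h3t, h1, ha, hb, hu, hB]
    module
  have DJ : D * Jm n = 0 := by rw [hD, Matrix.sub_mul, r1, r2, sub_self]
  have hDC : D * C = (-(1 + c)) • D := by
    have : C = Jm n - 1 - B := by rw [← hJ']; abel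
    rw [this, Matrix.mul_sub, Matrix.mul_sub, DJ, Matrix.mul_one, hDB]
    module
  have hac : a = -c := by
    have e1 : (D * D * B).trace = c * (D * D).trace := by
      rw [Matrix.mul_assoc, hDB, Matrix.mul_smul, Matrix.trace_smul, smul_eq_mul]
    have e2 : (D * D * B).trace = a * (2 * (n * p)) := by
      rw [hDD, hB]
      simp only [Matrix.add_mul, Matrix.mul_add, Matrix.smul_mul, Matrix.trace_add,
        Matrix.trace_smul, trCP, trCPt, trPP, trPtPt, trPtP, tP, Matrix.one_mul, trP,
        Matrix.trace_transpose, smul_eq_mul]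
      ring
    rw [e2, trDD, tP] at e1
    apply mul_right_cancel₀ hpne
    linarith
  have k1 : -(2 * (p : ℝ)) + a * c + b * (-(1 + c)) = - n := by
    apply hDne
    have e1 : D * (D * D) = (-(2 * (p : ℝ)) + a * c + b * (-(1 + c))) • D := by
      conv_lhs => rw [hDD]
      simp only [Matrix.mul_add, Matrix.mul_smul, hDB, hDC, Matrix.mul_one]
      module
    have e2 : D * (D * D) = (-n : ℝ) • D := by
      have hED : E * D = 0 := by rw [hanti, hDE0, neg_zero]
      have : D * D = Jm n - (n : ℝ) • 1 - E * E := by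
        rw [← hS1', hDE0, hED]; abel
      rw [this, Matrix.mul_sub, Matrix.mul_sub, DJ, Matrix.mul_smul, Matrix.mul_one,
        ← Matrix.mul_assoc, hDE0, Matrix.zero_mul]
      module
    rw [← e1, e2]
  have k2 : -(2 * (p : ℝ)) + a * (2 * p) + b * l = 0 := by
    apply Jm_smul_inj hn
    have h := congrArg (· * Jm n) hDD
    simp only [Matrix.add_mul, Matrix.smul_mul, Matrix.mul_assoc, DJ, r1, r2, r3, Matrix.mul_zero,
      hB, smul_smul, Matrix.one_mul] at h
    rw [zero_smul, h]; module
  have hnl : (n : ℝ) = 1 + 2 * p + l := by rw [hl]; ring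
  have k3 : (((n : ℝ) - 1) * c + 2 * p) ^ 2 = l ^ 2 * n := by
    rw [hac, hnl] at k1
    rw [hac] at k2
    rw [hnl]
    have k1' : c ^ 2 + b * (1 + c) = 1 + l := by linarith
    have k2' : b * l = 2 * p * (1 + c) := by linarith
    have k4 : l * c ^ 2 + 2 * p * (1 + c) ^ 2 = l + l ^ 2 := by
      linear_combination l * k1' - (1 + c) * k2'
    linear_combination (l + 2 * p) * k4
  have hlnat : ∃ L : ℕ, (L : ℝ) = l := by
    have h : (2 * p + 1 : ℕ) ≤ n := by
      have : ((2 * p + 1 : ℕ) : ℝ) ≤ n := by push_cast; linarith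
      exact_mod_cast this
    refine ⟨n - (2 * p + 1), ?_⟩
    rw [Nat.cast_sub h, hl]; push_cast; ring
  obtain ⟨L, hL⟩ := hlnat
  refine arith (n := n) (m := m) (k := 2 * p) (l := L) (c := (v : ℤ) - w) hm ?_ ?_
  · have : (0 : ℝ) < L := by rw [hL]; exact hlpos
    exact_mod_cast this
  · rw [← hL, hc] at k3
    exact_mod_cast k3

lemma fusion_mul {n : ℕ} {A : Fin 5 → Matrix (Fin n) (Fin n) ℝ} {Λ : Finset (Finset (Fin 5))}
    (h : GivesFusion n A 0 Λ) {C D : Finset (Fin 5)} (hC : C ∈ Λ) (hD : D ∈ Λ) :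
    ∃ p : Finset (Fin 5) → ℕ, (∑ i ∈ C, A i) * (∑ i ∈ D, A i) =
      ∑ E ∈ Λ, (p E : ℝ) • ∑ i ∈ E, A i := by
  obtain ⟨_, _, _, _, _, _, _, _, h⟩ := h
  obtain ⟨p, hp⟩ := h ⟨C, hC⟩ ⟨D, hD⟩
  refine ⟨fun E => if hE : E ∈ Λ then p ⟨E, hE⟩ else 0, ?_⟩
  rw [← Finset.sum_coe_sort Λ]
  refine hp.trans ?_
  refine Finset.sum_congr rfl fun E _ => ?_
  simp only [dif_pos E.2]

lemma fusion3 {n : ℕ} {A : Fin 5 → Matrix (Fin n) (Fin n) ℝ} {σ : Fin 5 → Fin 5}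
    (ham : Amorphous n A 0 σ) (hA0 : A 0 = 1) (h0 : σ 0 = 0)
    {a s b r : Fin 5} (ha : σ a = s) (hs : σ s = a) (hb : σ b = r) (hr : σ r = b)
    (d1 : a ≠ 0) (d2 : s ≠ 0) (d3 : b ≠ 0) (d4 : r ≠ 0) (d5 : a ≠ s) (d6 : a ≠ b) (d7 : a ≠ r)
    (d8 : s ≠ b) (d9 : s ≠ r) (d10 : b ≠ r)
    (hall : ∀ i : Fin 5, i = 0 ∨ i = a ∨ i = s ∨ i = b ∨ i = r) :
    ∃ x y z : ℕ, (A a + A b) * (A s + A r) = (x : ℝ) • (1 : Matrix (Fin n) (Fin n) ℝ)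
      + (y : ℝ) • (A a + A b) + (z : ℝ) • (A s + A r) := by
  have n1 : ({0} : Finset (Fin 5)) ≠ {a, b} := fun h => by
    have : a ∈ ({0} : Finset (Fin 5)) := by rw [h]; simp
    simp [d1] at this
  have n2 : ({0} : Finset (Fin 5)) ≠ {s, r} := fun h => by
    have : s ∈ ({0} : Finset (Fin 5)) := by rw [h]; simp
    simp [d2] at this
  have n3 : ({a, b} : Finset (Fin 5)) ≠ {s, r} := fun h => by
    have : a ∈ ({s, r} : Finset (Fin 5)) := by rw [← h]; simp
    simp [d5, d7] at this
  have key := ham {{0}, {a, b}, {s, r}} ?_ ?_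
  · obtain ⟨p, hp⟩ := fusion_mul key (C := {a, b}) (D := {s, r}) (by simp) (by simp)
    refine ⟨p {0}, p {a, b}, p {s, r}, ?_⟩
    have hsum : ∀ f : Finset (Fin 5) → Matrix (Fin n) (Fin n) ℝ,
        ∑ E ∈ {{0}, {a, b}, {s, r}}, f E = f {0} + f {a, b} + f {s, r} := fun f => by
      rw [Finset.sum_insert (by simp [n1, n2]), Finset.sum_pair n3, add_assoc]
    rw [hsum, Finset.sum_pair d6, Finset.sum_pair d9, Finset.sum_singleton, hA0] at hp
    exact hp
  · refine ⟨by simp, fun i => ?_⟩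
    rcases hall i with h | h | h | h | h
    · refine ⟨{0}, by simp [h], ?_⟩
      rintro C ⟨hC, hi⟩
      simp only [Finset.mem_insert, Finset.mem_singleton] at hC
      rcases hC with rfl | rfl | rfl <;>
        first | rfl | (exfalso; rw [h] at hi; simp only [Finset.mem_insert, Finset.mem_singleton] at hi; grind only)
    · refine ⟨{a, b}, by simp [h], ?_⟩
      rintro C ⟨hC, hi⟩
      simp only [Finset.mem_insert, Finset.mem_singleton] at hC
      rcases hC with rfl | rfl | rfl <;>
        first | rfl | (exfalso; rw [h] at hi; simp only [Finset.mem_insert, Finset.mem_singleton] at hi; grind only)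
    · refine ⟨{s, r}, by simp [h], ?_⟩
      rintro C ⟨hC, hi⟩
      simp only [Finset.mem_insert, Finset.mem_singleton] at hC
      rcases hC with rfl | rfl | rfl <;>
        first | rfl | (exfalso; rw [h] at hi; simp only [Finset.mem_insert, Finset.mem_singleton] at hi; grind only)
    · refine ⟨{a, b}, by simp [h], ?_⟩
      rintro C ⟨hC, hi⟩
      simp only [Finset.mem_insert, Finset.mem_singleton] at hC
      rcases hC with rfl | rfl | rfl <;>
        first | rfl | (exfalso; rw [h] at hi; simp only [Finset.mem_insert, Finset.mem_singleton] at hi; grind only)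
    · refine ⟨{s, r}, by simp [h], ?_⟩
      rintro C ⟨hC, hi⟩
      simp only [Finset.mem_insert, Finset.mem_singleton] at hC
      rcases hC with rfl | rfl | rfl <;>
        first | rfl | (exfalso; rw [h] at hi; simp only [Finset.mem_insert, Finset.mem_singleton] at hi; grind only)
  · refine ⟨by simp, fun C hC => ?_⟩
    simp only [Finset.mem_insert, Finset.mem_singleton] at hC
    rcases hC with rfl | rfl | rfl <;>
      simp [Finset.image_insert, Finset.image_singleton, h0, ha, hb, hs, hr]

lemma fusion4 {n : ℕ} {A : Fin 5 → Matrix (Fin n) (Fin n) ℝ} {σ : Fin 5 → Fin 5}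
    (ham : Amorphous n A 0 σ) (hA0 : A 0 = 1) (h0 : σ 0 = 0)
    {a s b r : Fin 5} (ha : σ a = s) (hs : σ s = a) (hb : σ b = r) (hr : σ r = b)
    (d1 : a ≠ 0) (d2 : s ≠ 0) (d3 : b ≠ 0) (d4 : r ≠ 0) (d5 : a ≠ s) (d6 : a ≠ b) (d7 : a ≠ r)
    (d8 : s ≠ b) (d9 : s ≠ r) (d10 : b ≠ r)
    (hall : ∀ i : Fin 5, i = 0 ∨ i = a ∨ i = s ∨ i = b ∨ i = r) (i j : Fin 5)
    (hi : i = a ∨ i = s) (hj : j = a ∨ j = s) :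
    ∃ x y z w : ℕ, A i * A j = (x : ℝ) • (1 : Matrix (Fin n) (Fin n) ℝ)
      + (y : ℝ) • A a + (z : ℝ) • A s + (w : ℝ) • (A b + A r) := by
  have n1 : ({0} : Finset (Fin 5)) ≠ {b, r} := fun h => by
    have : b ∈ ({0} : Finset (Fin 5)) := by rw [h]; simp
    simp [d3] at this
  have n2 : ({a} : Finset (Fin 5)) ≠ {b, r} := fun h => by
    have : b ∈ ({a} : Finset (Fin 5)) := by rw [h]; simp
    simp [d6.symm] at this
  have n3 : ({s} : Finset (Fin 5)) ≠ {b, r} := fun h => by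
    have : b ∈ ({s} : Finset (Fin 5)) := by rw [h]; simp
    simp [d8.symm] at this
  have key := ham {{0}, {a}, {s}, {b, r}} ?_ ?_
  · obtain ⟨p, hp⟩ := fusion_mul key (C := {i}) (D := {j})
      (by rcases hi with rfl | rfl <;> simp) (by rcases hj with rfl | rfl <;> simp)
    refine ⟨p {0}, p {a}, p {s}, p {b, r}, ?_⟩
    have hsum : ∀ f : Finset (Fin 5) → Matrix (Fin n) (Fin n) ℝ,
        ∑ E ∈ {{0}, {a}, {s}, {b, r}}, f E = f {0} + f {a} + f {s} + f {b, r} := fun f => by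
      rw [Finset.sum_insert (by simp [n1, d1.symm, d2.symm]),
        Finset.sum_insert (by simp [n2, d5]), Finset.sum_pair n3, add_assoc, add_assoc]
    rw [hsum, Finset.sum_pair d10] at hp
    simp only [Finset.sum_singleton, hA0] at hp
    exact hp
  · refine ⟨by simp, fun i => ?_⟩
    rcases hall i with h | h | h | h | h
    · refine ⟨{0}, by simp [h], ?_⟩
      rintro C ⟨hC, hi⟩
      simp only [Finset.mem_insert, Finset.mem_singleton] at hC
      rcases hC with rfl | rfl | rfl | rfl <;>
        first | rfl | (exfalso; rw [h] at hi; simp only [Finset.mem_insert, Finset.mem_singleton] at hi; grind only)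
    · refine ⟨{a}, by simp [h], ?_⟩
      rintro C ⟨hC, hi⟩
      simp only [Finset.mem_insert, Finset.mem_singleton] at hC
      rcases hC with rfl | rfl | rfl | rfl <;>
        first | rfl | (exfalso; rw [h] at hi; simp only [Finset.mem_insert, Finset.mem_singleton] at hi; grind only)
    · refine ⟨{s}, by simp [h], ?_⟩
      rintro C ⟨hC, hi⟩
      simp only [Finset.mem_insert, Finset.mem_singleton] at hC
      rcases hC with rfl | rfl | rfl | rfl <;>
        first | rfl | (exfalso; rw [h] at hi; simp only [Finset.mem_insert, Finset.mem_singleton] at hi; grind only)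
    · refine ⟨{b, r}, by simp [h], ?_⟩
      rintro C ⟨hC, hi⟩
      simp only [Finset.mem_insert, Finset.mem_singleton] at hC
      rcases hC with rfl | rfl | rfl | rfl <;>
        first | rfl | (exfalso; rw [h] at hi; simp only [Finset.mem_insert, Finset.mem_singleton] at hi; grind only)
    · refine ⟨{b, r}, by simp [h], ?_⟩
      rintro C ⟨hC, hi⟩
      simp only [Finset.mem_insert, Finset.mem_singleton] at hC
      rcases hC with rfl | rfl | rfl | rfl <;>
        first | rfl | (exfalso; rw [h] at hi; simp only [Finset.mem_insert, Finset.mem_singleton] at hi; grind only)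
  · refine ⟨by simp, fun C hC => ?_⟩
    simp only [Finset.mem_insert, Finset.mem_singleton] at hC
    rcases hC with rfl | rfl | rfl | rfl <;>
      simp [Finset.image_insert, Finset.image_singleton, h0, ha, hb, hs, hr, Finset.pair_comm]

lemma five_cases : ∀ a s b r : Fin 5, a ≠ 0 → s ≠ 0 → b ≠ 0 → r ≠ 0 → a ≠ s → a ≠ b → a ≠ r →
    s ≠ b → s ≠ r → b ≠ r → ∀ i : Fin 5, i = 0 ∨ i = a ∨ i = s ∨ i = b ∨ i = r := by
  intro a s b r
  omega

/-- **Theorem 1.1.** There is no skew-symmetric amorphous association scheme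
with 4 classes. -/
theorem no_skewSymmetric_amorphous_four_classes
    (n : ℕ) (hn : 1 ≤ n)
    (A : Fin 5 → Matrix (Fin n) (Fin n) ℝ) (σ : Fin 5 → Fin 5)
    (hA : IsAssocScheme n A 0 σ)
    (hskew : ∀ i, (A i)ᵀ = A i ↔ i = 0) :
    ¬ Amorphous n A 0 σ := by
  intro ham
  obtain ⟨hne, h01, hA0, hsum, hσ, hmul⟩ := hA
  have hnn : ∀ i x y, 0 ≤ A i x y := fun i x y => by
    rcases h01 i x y with h | h <;> simp [h]
  have inj : Function.Injective A := by
    intro i j hij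
    by_contra hc
    obtain ⟨x, y, hxy⟩ := exists_one (hne i) (h01 i)
    have e := congrFun (congrFun hsum x) y
    rw [Matrix.sum_apply] at e
    have h2 : ∑ k ∈ {i, j}, A k x y ≤ ∑ k, A k x y :=
      Finset.sum_le_sum_of_subset_of_nonneg (Finset.subset_univ _) fun k _ _ => hnn k x y
    rw [e, Finset.sum_pair hc, ← hij, hxy] at h2
    norm_num at h2
  have inv : ∀ i, σ (σ i) = i := fun i => inj (by rw [← hσ, ← hσ, Matrix.transpose_transpose])
  have h0 : σ 0 = 0 := inj (by rw [← hσ, hA0, Matrix.transpose_one])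
  have hfix : ∀ i, i ≠ 0 → σ i ≠ i := fun i hi h => hi ((hskew i).1 (by rw [hσ, h]))
  have hz : ∀ i, i ≠ 0 → σ i ≠ 0 := fun i hi h => hi (by rw [← inv i, h, h0])
  obtain ⟨b, hb0, hb1, hbs⟩ : ∃ b : Fin 5, b ≠ 0 ∧ b ≠ 1 ∧ b ≠ σ 1 := by
    generalize σ 1 = s
    revert s; decide
  obtain ⟨a, ha⟩ : ∃ a : Fin 5, a = 1 := ⟨_, rfl⟩
  rw [← ha] at hb1 hbs
  have d1 : a ≠ 0 := by rw [ha]; decide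
  obtain ⟨s, hs⟩ : ∃ s, σ a = s := ⟨_, rfl⟩
  obtain ⟨r, hr⟩ : ∃ r, σ b = r := ⟨_, rfl⟩
  have hs' : σ s = a := by rw [← hs, inv]
  have hr' : σ r = b := by rw [← hr, inv]
  have d2 : s ≠ 0 := hs ▸ hz a d1
  have d4 : r ≠ 0 := hr ▸ hz b hb0
  have d5 : a ≠ s := fun h => hfix a d1 (hs.trans h.symm)
  have d6 : a ≠ b := hb1.symm
  have d7 : a ≠ r := fun h => hbs (by rw [h, hr'])
  have d8 : s ≠ b := fun h => hbs (by rw [hs, h])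
  have d9 : s ≠ r := fun h => d6 (by rw [← hs', h, hr'])
  have d10 : b ≠ r := fun h => hfix b hb0 (hr.trans h.symm)
  have hall := five_cases a s b r d1 d2 hb0 d4 d5 d6 d7 d8 d9 d10
  have hall' : ∀ i : Fin 5, i = 0 ∨ i = a ∨ i = s ∨ i = r ∨ i = b := fun i => by
    rcases hall i with h | h | h | h | h <;> simp [h]
  have huniv : (Finset.univ : Finset (Fin 5)) = {0, a, s, b, r} := by
    ext i; simpa using hall i
  have hexp : ∀ f : Fin 5 → Matrix (Fin n) (Fin n) ℝ,
      ∑ i, f i = f 0 + f a + f s + f b + f r := fun f => by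
    rw [huniv, Finset.sum_insert (by simp [d1.symm, d2.symm, hb0.symm, d4.symm]),
      Finset.sum_insert (by simp [d5, d6, d7]), Finset.sum_insert (by simp [d8, d9]),
      Finset.sum_pair d10]
    abel
  have As : (A a)ᵀ = A s := by rw [hσ, hs]
  have Ar : (A b)ᵀ = A r := by rw [hσ, hr]
  have Ar' : (A r)ᵀ = A b := by rw [hσ, hr']
  refine core hn (hne a) (hne b) (h01 a) (h01 b) ?_ ?_ ?_ ?_ ?_ ?_ ?_
  · rw [As, Ar, ← hA0, ← hexp A, hsum]; rfl
  · rw [Matrix.transpose_add, As, Ar]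
    exact fusion3 ham hA0 h0 hs hs' hr hr' d1 d2 hb0 d4 d5 d6 d7 d8 d9 d10 hall
  · rw [Matrix.transpose_add, As, Ar, Ar']
    exact fusion3 ham hA0 h0 hs hs' hr' hr d1 d2 d4 hb0 d5 d7 d6 d9 d8 d10.symm hall'
  · rw [As, Ar]
    exact fusion4 ham hA0 h0 hs hs' hr hr' d1 d2 hb0 d4 d5 d6 d7 d8 d9 d10 hall a s
      (Or.inl rfl) (Or.inr rfl)
  · rw [As, Ar]
    exact fusion4 ham hA0 h0 hs hs' hr hr' d1 d2 hb0 d4 d5 d6 d7 d8 d9 d10 hall s a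
      (Or.inr rfl) (Or.inl rfl)
  · rw [As, Ar]
    exact fusion4 ham hA0 h0 hs hs' hr hr' d1 d2 hb0 d4 d5 d6 d7 d8 d9 d10 hall a a
      (Or.inl rfl) (Or.inl rfl)
  · rw [As, Ar]
    obtain ⟨p1, q1⟩ := hmul a b
    obtain ⟨p2, q2⟩ := hmul a r
    obtain ⟨p3, q3⟩ := hmul s b
    obtain ⟨p4, q4⟩ := hmul s r
    rw [hexp, hA0] at q1 q2 q3 q4
    refine ⟨p1 0 - p2 0 - (p3 0 - p4 0), p1 a - p2 a - (p3 a - p4 a),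
      p1 s - p2 s - (p3 s - p4 s), p1 b - p2 b - (p3 b - p4 b), p1 r - p2 r - (p3 r - p4 r), ?_⟩
    rw [Matrix.sub_mul, Matrix.mul_sub, Matrix.mul_sub, q1, q2, q3, q4]
    module
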